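/- Let F = 𝔽_q with q a prime power and let L be the field extension of F of prime degree r, with Gal(L/F) generated by σ. Define the equivalence relation on L \ F by a ∼ b if and only if the nonassociative cyclic algebras (L/F, σ, a) and (L/F, σ, b) are isomorphic as F-algebras. If r divides q−1 then the number of equivalence classes (equivalently, the number of pairwise non-isomorphic semifields of the form (L/F, σ, a)) is r − 1 + (q^r − q − (q−1)(r−1)) / (r(q−1)). If r does not divide q−1 then the number of equivalence classes is (q^r − q) / (r(q−1)). -/

import Mathlib

noncomputable section

/-- Multiplication of the nonassociative cyclic algebra `(L/F, σ, a)` of degree `n`. -/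
def cycMul {F L : Type*} [Field F] [Field L] [Algebra F L] (n : ℕ)
    (σ : L ≃ₐ[F] L) (a : L) (x y : Fin n → L) : Fin n → L :=
  fun k => ∑ i : Fin n, ∑ j : Fin n,
    if (i : ℕ) + (j : ℕ) = (k : ℕ) then x i * (σ ^ (i : ℕ)) (y j)
    else if (i : ℕ) + (j : ℕ) = (k : ℕ) + n then x i * (σ ^ (i : ℕ)) (y j) * a
    else 0

/-- The unit element `1 = z^0` of `(L/F, σ, a)`. -/
def cycOne (L : Type*) [Field L] (n : ℕ) : Fin n → L :=
  fun k => if (k : ℕ) = 0 then 1 else 0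

/-- The relation `a ∼ b` on `L \ F` given by: the nonassociative cyclic algebras
`(L/F, σ, a)` and `(L/F, σ, b)` are isomorphic as `F`-algebras. -/
def sandlerRel {F L : Type*} [Field F] [Field L] [Algebra F L] (n : ℕ) (σ : L ≃ₐ[F] L)
    (a b : {x : L // x ∉ Set.range (algebraMap F L)}) : Prop :=
  ∃ e : (Fin n → L) ≃ₗ[F] (Fin n → L),
    (∀ x y : Fin n → L, e (cycMul n σ a.1 x y) = cycMul n σ b.1 (e x) (e y)) ∧
    e (cycOne L n) = cycOne L n

namespace CycAlg

section General

variable {F L : Type*} [Field F] [Field L] [Algebra F L] {m : ℕ} (σ : L ≃ₐ[F] L) (a : L)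

theorem cycMul_single_zero_left (c : L) (y : Fin (m + 2) → L) (k : Fin (m + 2)) :
    cycMul (m + 2) σ a (Pi.single 0 c) y k = c * y k := by
  unfold cycMul
  rw [Finset.sum_eq_single 0, Finset.sum_eq_single k]
  · simp
  · intro j _ hj
    have h : (j : ℕ) ≠ k := fun h => hj (Fin.ext h)
    have h' : (j : ℕ) ≠ k + (m + 2) := by omega
    simp [h, h']
  · simp
  · intro i _ hi
    simp [hi]
  · simp

theorem cycMul_single_right (x : Fin (m + 2) → L) (j : Fin (m + 2)) (y : L) (k : Fin (m + 2)) :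
    cycMul (m + 2) σ a x (Pi.single j y) k =
      x (k - j) * (σ ^ ((k - j : Fin (m + 2)) : ℕ)) y * (if j ≤ k then 1 else a) := by
  unfold cycMul
  have hcomm : ∀ f : Fin (m + 2) → Fin (m + 2) → L, (∀ i l, l ≠ j → f i l = 0) →
      (∀ i, i ≠ k - j → f i j = 0) → ∑ i, ∑ l, f i l = f (k - j) j := by
    intro f h1 h2
    rw [Finset.sum_eq_single (k - j), Finset.sum_eq_single j]
    · intro l _ h; exact h1 _ _ h
    · simp
    · intro i _ hi
      apply Finset.sum_eq_zero
      intro l _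
      by_cases h : l = j
      · subst h; exact h2 _ hi
      · exact h1 _ _ h
    · simp
  rw [hcomm]
  · rw [Pi.single_eq_same]
    by_cases h : j ≤ k
    · have e : ((k - j : Fin (m + 2)) : ℕ) = k - j := Fin.sub_val_of_le h
      have h' : (j : ℕ) ≤ k := h
      rw [if_pos (by omega), if_pos h, mul_one]
    · have h' : (k : ℕ) < j := by simpa using h
      have e : ((k - j : Fin (m + 2)) : ℕ) = m + 2 + k - j := Fin.coe_sub_iff_lt.2 h'
      rw [if_neg (by omega), if_pos (by omega), if_neg h]
  · intro i l h
    simp [h]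
  · intro i h
    have hk : ∀ n : ℕ, (i : ℕ) + j = n → (n = k ∨ n = k + (m + 2)) → False := by
      intro n hn hn'
      apply h
      rw [eq_sub_iff_add_eq]
      apply Fin.ext
      rw [Fin.val_add, hn]
      rcases hn' with rfl | rfl
      · exact Nat.mod_eq_of_lt k.2
      · rw [Nat.add_mod_right]; exact Nat.mod_eq_of_lt k.2
    rw [if_neg fun h' => hk _ h' (Or.inl rfl), if_neg fun h' => hk _ h' (Or.inr rfl)]

theorem cycMul_single_zero_right (x : Fin (m + 2) → L) (c : L) (k : Fin (m + 2)) :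
    cycMul (m + 2) σ a x (Pi.single 0 c) k = x k * (σ ^ (k : ℕ)) c := by
  simp [cycMul_single_right]

theorem cycMul_single_one_left (c : L) (y : L) (j k : Fin (m + 2)) :
    cycMul (m + 2) σ a (Pi.single 1 c) (Pi.single j y) k =
      if k = j + 1 then c * σ y * (if j ≤ k then 1 else a) else 0 := by
  rw [cycMul_single_right]
  by_cases h : k = j + 1
  · subst h
    simp
  · rw [if_neg h, Pi.single_eq_of_ne]
    · simp
    · intro h'
      exact h (by rw [← h', add_sub_cancel])

theorem cycMul_one_castSucc (c y : L) (j : Fin (m + 1)) :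
    cycMul (m + 2) σ a (Pi.single 1 c) (Pi.single j.castSucc y) = Pi.single j.succ (c * σ y) := by
  ext k
  rw [cycMul_single_one_left, ← Fin.coeSucc_eq_succ]
  by_cases h : k = j.castSucc + 1
  · subst h
    rw [Pi.single_eq_same, if_pos rfl, if_pos, mul_one]
    rw [Fin.coeSucc_eq_succ]
    exact (Fin.castSucc_lt_succ (i := j)).le
  · rw [if_neg h, Pi.single_eq_of_ne h]

theorem cycMul_one_last (c y : L) :
    cycMul (m + 2) σ a (Pi.single 1 c) (Pi.single (Fin.last (m + 1)) y) =
      Pi.single 0 (c * σ y * a) := by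
  ext k
  rw [cycMul_single_one_left, Fin.last_add_one]
  by_cases h : k = 0
  · subst h
    simp
  · rw [if_neg h, Pi.single_eq_of_ne h]

/-- The left nucleus of `(L/F, σ, a)` consists of the elements concentrated in degree zero. -/
theorem eq_single_of_assoc (ha : ∀ i : Fin (m + 2), i ≠ 0 → (σ ^ (i : ℕ)) a ≠ a)
    (u : Fin (m + 2) → L)
    (hu : ∀ x y, cycMul (m + 2) σ a (cycMul (m + 2) σ a u x) y =
      cycMul (m + 2) σ a u (cycMul (m + 2) σ a x y)) : u = Pi.single 0 (u 0) := by
  have key := hu (Pi.single 1 1) (Pi.single (Fin.last (m + 1)) 1)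
  rw [cycMul_one_last] at key
  ext i
  by_cases hi : i = 0
  · subst hi; simp
  rw [Pi.single_eq_of_ne hi]
  have h := congrFun key i
  have hlast : i - Fin.last (m + 1) = i + 1 := by
    rw [sub_eq_iff_eq_add, add_assoc, add_comm 1, Fin.last_add_one, add_zero]
  rw [cycMul_single_right, cycMul_single_right, cycMul_single_zero_right, hlast,
    add_sub_cancel_right] at h
  simp only [map_one, mul_one, one_mul] at h
  have hfac : (if (1 : Fin (m + 2)) ≤ i + 1 then (1 : L) else a) *
      (if Fin.last (m + 1) ≤ i then 1 else a) = a := by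
    by_cases hl : i = Fin.last (m + 1)
    · subst hl
      simp
    · rw [if_pos, if_neg, one_mul]
      · rwa [Fin.last_le_iff]
      · have hlt : (i : ℕ) < m + 1 := by
          have := Fin.val_ne_of_ne hl
          have := i.2
          simp only [Fin.val_last] at *
          omega
        rw [Fin.le_def, Fin.val_add_one_of_lt (Fin.lt_def.2 hlt)]
        simp
  rw [mul_assoc, hfac] at h
  by_contra hne
  exact ha i hi (mul_left_cancel₀ hne h).symm

end General
section TwistedPow

variable {F L : Type*} [Field F] [Field L] [Algebra F L] (σ : L ≃ₐ[F] L)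

/-- The twisted power `k σ(k) ⋯ σ^{j-1}(k)`. -/
def twistedPow (k : L) (j : ℕ) : L := ∏ t ∈ Finset.range j, (σ ^ t) k

theorem twistedPow_zero (k : L) : twistedPow σ k 0 = 1 := by simp [twistedPow]

theorem twistedPow_add (k : L) (i j : ℕ) :
    twistedPow σ k (i + j) = twistedPow σ k i * (σ ^ i) (twistedPow σ k j) := by
  simp only [twistedPow, Finset.prod_range_add, map_prod, pow_add, AlgEquiv.mul_apply]

theorem twistedPow_succ (k : L) (j : ℕ) :
    twistedPow σ k (j + 1) = k * σ (twistedPow σ k j) := by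
  rw [add_comm, twistedPow_add]
  simp [twistedPow]

theorem twistedPow_ne_zero {k : L} (hk : k ≠ 0) (j : ℕ) : twistedPow σ k j ≠ 0 :=
  Finset.prod_ne_zero_iff.2 fun t _ => (map_ne_zero (σ ^ t)).2 hk

variable [FiniteDimensional F L] [IsGalois F L] {σ}

theorem orderOf_eq_finrank (hσ : ∀ τ : L ≃ₐ[F] L, τ ∈ Subgroup.zpowers σ) :
    orderOf σ = Module.finrank F L := by
  rw [orderOf_eq_card_of_forall_mem_zpowers hσ, IsGalois.card_aut_eq_finrank]

theorem algebraMap_norm_eq_twistedPow (hσ : ∀ τ : L ≃ₐ[F] L, τ ∈ Subgroup.zpowers σ) (k : L) :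
    algebraMap F L (Algebra.norm F k) = twistedPow σ k (Module.finrank F L) := by
  classical
  rw [Algebra.norm_eq_prod_automorphisms, twistedPow, ← orderOf_eq_finrank hσ,
    ← IsCyclic.image_range_orderOf hσ, Finset.prod_image]
  intro i hi j hj h
  exact pow_injOn_Iio_orderOf (by simpa using hi) (by simpa using hj) h

theorem mem_range_algebraMap_of_generator {τ : L ≃ₐ[F] L}
    (hτ : ∀ ρ : L ≃ₐ[F] L, ρ ∈ Subgroup.zpowers τ) {x : L} (hx : τ x = x) :
    x ∈ Set.range (algebraMap F L) := by
  rw [IsGalois.mem_range_algebraMap_iff_fixed]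
  intro ρ
  have h : Subgroup.zpowers τ ≤ MulAction.stabilizer (L ≃ₐ[F] L) x := by
    rw [Subgroup.zpowers_le]
    exact hx
  exact h (hτ ρ)

end TwistedPow

section Isomorphism

variable {F L : Type*} [Field F] [Field L] [Algebra F L] {m : ℕ} {σ : L ≃ₐ[F] L} {a b : L}

theorem exists_linearEquiv_of_twistedPow (hσ1 : σ ^ (m + 2) = 1) (τ : L ≃ₐ[F] L)
    (hcomm : Commute σ τ)
    {k : L} (hk : k ≠ 0) (h : τ a = twistedPow σ k (m + 2) * b) :
    ∃ e : (Fin (m + 2) → L) ≃ₗ[F] (Fin (m + 2) → L),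
      (∀ x y, e (cycMul (m + 2) σ a x y) = cycMul (m + 2) σ b (e x) (e y)) ∧
      e (cycOne L (m + 2)) = cycOne L (m + 2) := by
  have hP := twistedPow_ne_zero σ hk
  let e : (Fin (m + 2) → L) ≃ₗ[F] (Fin (m + 2) → L) := LinearEquiv.piCongrRight fun j =>
    τ.toLinearEquiv.trans (DistribMulAction.toLinearEquiv F L (Units.mk0 _ (hP j)))
  have he : ∀ x j, e x j = twistedPow σ k j * τ (x j) := fun x j => rfl
  have hτ : ∀ (i : ℕ) (x : L), τ ((σ ^ i) x) = (σ ^ i) (τ x) := fun i x =>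
    (DFunLike.congr_fun (hcomm.pow_left i).eq x).symm
  refine ⟨e, fun x y => ?_, ?_⟩
  · ext l
    rw [he]
    simp only [cycMul, map_sum, Finset.mul_sum, he]
    refine Finset.sum_congr rfl fun i _ => Finset.sum_congr rfl fun j _ => ?_
    split_ifs with h1 h2
    · rw [← h1, twistedPow_add]
      simp only [map_mul, hτ]
      ring
    · have key : twistedPow σ k i * (σ ^ (i : ℕ)) (twistedPow σ k j) =
          twistedPow σ k (m + 2) * twistedPow σ k l := by
        rw [← twistedPow_add, h2, add_comm, twistedPow_add, hσ1]
        rfl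
      simp only [map_mul, hτ, h]
      linear_combination -(τ (x i) * (σ ^ (i : ℕ)) (τ (y j)) * b) * key
    · simp
  · ext l
    rw [he]
    by_cases hl : (l : ℕ) = 0
    · simp [cycOne, hl, twistedPow_zero]
    · simp [cycOne, hl]

theorem exists_twistedPow_of_linearEquiv [FiniteDimensional F L]
    (hinj : ∀ i < m + 2, σ ^ i = σ → i = 1) (hcomm : ∀ τ : L ≃ₐ[F] L, Commute σ τ)
    (hb : ∀ i : Fin (m + 2), i ≠ 0 → (σ ^ (i : ℕ)) b ≠ b)
    (e : (Fin (m + 2) → L) ≃ₗ[F] (Fin (m + 2) → L))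
    (hmul : ∀ x y, e (cycMul (m + 2) σ a x y) = cycMul (m + 2) σ b (e x) (e y))
    (hone : e (cycOne L (m + 2)) = cycOne L (m + 2)) :
    ∃ (τ : L ≃ₐ[F] L) (k : L), k ≠ 0 ∧ τ a = twistedPow σ k (m + 2) * b := by
  have h_one : (cycOne L (m + 2)) = Pi.single 0 1 := by
    ext l
    simp [cycOne, Pi.single_apply]
  rw [h_one] at hone
  -- the left nucleus is preserved
  have hnuc : ∀ c : L, e (Pi.single 0 c) = Pi.single 0 (e (Pi.single 0 c) 0) := by
    intro c
    apply eq_single_of_assoc σ b hb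
    intro x y
    obtain ⟨x, rfl⟩ := e.surjective x
    obtain ⟨y, rfl⟩ := e.surjective y
    rw [← hmul, ← hmul, ← hmul, ← hmul]
    congr 1
    have hleft : ∀ z, cycMul (m + 2) σ a (Pi.single 0 c) z = fun l => c * z l := fun z =>
      funext fun l => cycMul_single_zero_left σ a c z l
    rw [hleft, hleft]
    ext l
    simp only [cycMul, Finset.mul_sum]
    refine Finset.sum_congr rfl fun i _ => Finset.sum_congr rfl fun j _ => ?_
    split_ifs <;> ring
  have hsingle_mul : ∀ d c x : L, cycMul (m + 2) σ d (Pi.single 0 c) (Pi.single 0 x) =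
      Pi.single 0 (c * x) := by
    intro d c x
    ext l
    rw [cycMul_single_zero_left]
    simp [Pi.single_apply]
  let t : L →ₗ[F] L :=
    (LinearMap.proj 0) ∘ₗ e.toLinearMap ∘ₗ (LinearMap.single F (fun _ : Fin (m + 2) => L) 0)
  have ht : ∀ c, e (Pi.single 0 c) = Pi.single 0 (t c) := hnuc
  have ht1 : t 1 = 1 := by
    have := congrFun ((ht 1).symm.trans hone) 0
    simpa using this
  have htm : ∀ c d, t (c * d) = t c * t d := by
    intro c d
    have h := hmul (Pi.single 0 c) (Pi.single 0 d)
    rw [hsingle_mul, ht, ht, ht, hsingle_mul] at h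
    simpa using congrFun h 0
  let τ : L ≃ₐ[F] L :=
    (Algebra.IsAlgebraic.algEquivEquivAlgHom F L).symm (AlgHom.ofLinearMap t ht1 htm)
  have hτ : ∀ c, e (Pi.single 0 c) = Pi.single 0 (τ c) := ht
  -- the image of the generator is concentrated in degree one
  let w := e (Pi.single 1 1)
  have hw : w = Pi.single 1 (w 1) := by
    ext i
    by_cases hi : i = 1
    · subst hi; simp
    rw [Pi.single_eq_of_ne hi]
    by_contra hwi
    apply hi
    have hpow : σ ^ (i : ℕ) = σ := by
      have hrel : ∀ c, (σ ^ (i : ℕ)) (τ c) = τ (σ c) := by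
        intro c
        have h : cycMul (m + 2) σ a (Pi.single 1 1) (Pi.single 0 c) =
            cycMul (m + 2) σ a (Pi.single 0 (σ c)) (Pi.single 1 1) := by
          ext l
          rw [cycMul_single_zero_left, cycMul_single_zero_right]
          by_cases hl : l = 1
          · subst hl; simp
          · simp [hl]
        have h2 := congrArg e h
        rw [hmul, hmul, hτ, hτ] at h2
        have h3 := congrFun h2 i
        rw [cycMul_single_zero_left, cycMul_single_zero_right, mul_comm] at h3
        exact mul_right_cancel₀ hwi h3
      ext x
      have h := hrel (τ.symm x)
      have hc : τ (σ (τ.symm x)) = σ (τ (τ.symm x)) :=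
        (DFunLike.congr_fun (hcomm τ).eq (τ.symm x)).symm
      rw [hc, τ.apply_symm_apply] at h
      exact h
    have := hinj i i.2 hpow
    exact Fin.ext (by simpa using this)
  have hk : w 1 ≠ 0 := by
    intro h0
    rw [h0, Pi.single_zero] at hw
    have h1 : (Pi.single 1 1 : Fin (m + 2) → L) = 0 := e.map_eq_zero_iff.1 hw
    simpa using congrFun h1 1
  set k := w 1
  have hz : e (Pi.single 1 1) = Pi.single 1 k := hw
  have hpowers : ∀ j : Fin (m + 2), e (Pi.single j 1) = Pi.single j (twistedPow σ k j) := by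
    intro j
    induction j using Fin.induction with
    | zero => rw [hτ, map_one]; simp [twistedPow_zero]
    | succ j ih =>
      have h := hmul (Pi.single 1 1) (Pi.single j.castSucc 1)
      rw [hz, ih, cycMul_one_castSucc, cycMul_one_castSucc, map_one, mul_one] at h
      rw [h, Fin.val_succ, twistedPow_succ, Fin.val_castSucc]
  refine ⟨τ, k, hk, ?_⟩
  have h := hmul (Pi.single 1 1) (Pi.single (Fin.last (m + 1)) 1)
  rw [hz, hpowers, cycMul_one_last, cycMul_one_last, map_one, mul_one, one_mul, hτ] at h
  have h0 := congrFun h 0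
  rw [Pi.single_eq_same, Pi.single_eq_same] at h0
  rw [h0, twistedPow_succ, Fin.val_last]

end Isomorphism
section Counting

variable {F L : Type*} [Field F] [Field L] [Algebra F L]

theorem algebraMap_mul_algEquiv_notMem_range (c : Fˣ) (τ : L ≃ₐ[F] L) {x : L}
    (hx : x ∉ Set.range (algebraMap F L)) :
    algebraMap F L c * τ x ∉ Set.range (algebraMap F L) := by
  rintro ⟨y, hy⟩
  refine hx ⟨(c : F)⁻¹ * y, ?_⟩
  apply τ.injective
  rw [τ.commutes, map_mul, hy, map_inv₀, inv_mul_cancel_left₀]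
  simp

/-- The action of `Fˣ × Gal(L/F)` on `L \ F` given by `(c, τ) • x = c τ(x)`. -/
abbrev unitsProdGalAction (F L : Type*) [Field F] [Field L] [Algebra F L] :
    MulAction (Fˣ × (L ≃ₐ[F] L)) {x : L // x ∉ Set.range (algebraMap F L)} where
  smul g x := ⟨algebraMap F L g.1 * g.2 x, algebraMap_mul_algEquiv_notMem_range g.1 g.2 x.2⟩
  one_smul x := Subtype.ext (by
    change algebraMap F L ((1 : Fˣ) : F) * (1 : L ≃ₐ[F] L) x = x
    simp)
  mul_smul g h x := Subtype.ext (by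
    change algebraMap F L ((g.1 * h.1 : Fˣ) : F) * (g.2 * h.2) x =
      algebraMap F L g.1 * g.2 (algebraMap F L h.1 * h.2 x)
    simp [mul_assoc])

theorem sandlerRel_iff [Finite F] [FiniteDimensional F L] [IsGalois F L]
    (hr : (Module.finrank F L).Prime)
    {σ : L ≃ₐ[F] L} (hσ : ∀ τ : L ≃ₐ[F] L, τ ∈ Subgroup.zpowers σ)
    (a b : {x : L // x ∉ Set.range (algebraMap F L)}) :
    sandlerRel (Module.finrank F L) σ a b ↔
      ∃ (c : Fˣ) (τ : L ≃ₐ[F] L), τ a = algebraMap F L c * b := by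
  have : Finite L := Module.finite_of_finite F
  obtain ⟨m, hm⟩ : ∃ m, Module.finrank F L = m + 2 := ⟨_, (Nat.sub_add_cancel hr.two_le).symm⟩
  have hord := orderOf_eq_finrank hσ
  have hnorm := algebraMap_norm_eq_twistedPow hσ
  have hcard := IsGalois.card_aut_eq_finrank F L
  have hcomm : ∀ τ : L ≃ₐ[F] L, Commute σ τ := by
    intro τ
    obtain ⟨n, rfl⟩ := Subgroup.mem_zpowers_iff.1 (hσ τ)
    exact (Commute.refl σ).zpow_right n
  have : Fact (Module.finrank F L).Prime := ⟨hr⟩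
  rw [hm] at hord hnorm ⊢
  constructor
  · rintro ⟨e, hmul, hone⟩
    have hinj : ∀ i < m + 2, σ ^ i = σ → i = 1 := by
      intro i hi h
      exact pow_injOn_Iio_orderOf (x := σ) (by simpa [hord] using hi)
        (show 1 < orderOf σ by omega) (by simpa using h)
    have hb : ∀ i : Fin (m + 2), i ≠ 0 → (σ ^ (i : ℕ)) b.1 ≠ b.1 := by
      intro i hi h
      have hne : σ ^ (i : ℕ) ≠ 1 := by
        apply pow_ne_one_of_lt_orderOf
        · exact Fin.val_ne_zero_iff.2 hi
        · rw [hord]; exact i.2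
      exact b.2 (mem_range_algebraMap_of_generator
        (fun ρ => mem_zpowers_of_prime_card hcard hne) h)
    obtain ⟨τ, k, hk, h⟩ := exists_twistedPow_of_linearEquiv hinj hcomm hb e hmul hone
    rw [← hnorm] at h
    exact ⟨Units.mk0 _ (Algebra.norm_ne_zero_iff.2 hk), τ, h⟩
  · rintro ⟨c, τ, h⟩
    obtain ⟨k, hk⟩ := FiniteField.unitsMap_norm_surjective F L c
    have hk' : Algebra.norm F (k : L) = c := congrArg Units.val hk
    refine exists_linearEquiv_of_twistedPow ?_ τ (hcomm τ) k.ne_zero ?_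
    · rw [← hord, pow_orderOf_eq_one]
    · rw [← hnorm, hk', h]

/-- If `τ` generates the Galois group and the order of `c` divides that of `τ`, then `c⁻¹` is an
eigenvalue of `τ`. -/
theorem exists_unit_mul_algEquiv_eq [FiniteDimensional F L] {τ : L ≃ₐ[F] L}
    (hτ : ∀ ρ : L ≃ₐ[F] L, ρ ∈ Subgroup.zpowers τ) {c : Fˣ} (hc : orderOf c ∣ orderOf τ) :
    ∃ x : Lˣ, algebraMap F L c * τ x = x := by
  let φ : (L ≃ₐ[F] L) →* Lˣ := (Units.map (algebraMap F L).toMonoidHom).comp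
    (monoidHomOfForallMemZpowers hτ hc)
  have hφ : groupCohomology.IsMulCocycle₁ φ := by
    intro g h
    have hg : g • φ h = φ h := Units.ext (g.commutes _)
    rw [hg, map_mul, mul_comm]
  obtain ⟨y, hy⟩ := groupCohomology.isMulCoboundary₁_of_isMulCocycle₁_of_aut_to_units φ hφ
  have h1 := hy τ
  have h2 : φ τ = Units.map (algebraMap F L).toMonoidHom c := by
    simp only [φ, MonoidHom.comp_apply, monoidHomOfForallMemZpowers_apply_gen]
  rw [h2, div_eq_iff_eq_mul] at h1
  have h3 : τ (y : L) = algebraMap F L c * y := congrArg Units.val h1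
  refine ⟨y⁻¹, ?_⟩
  rw [Units.val_inv_eq_inv_val, map_inv₀, h3]
  have := y.ne_zero
  have : algebraMap F L c ≠ 0 := by simp
  field_simp

theorem card_notMem_range_algebraMap [Fintype F] [FiniteDimensional F L] :
    Nat.card {x : L // x ∉ Set.range (algebraMap F L)} =
      Fintype.card F ^ Module.finrank F L - Fintype.card F := by
  classical
  have : Finite L := Module.finite_of_finite F
  have := Fintype.ofFinite L
  rw [Nat.card_eq_fintype_card, Fintype.card_subtype_compl, Module.card_eq_pow_finrank (K := F)]
  congr 1
  exact (Fintype.card_congr (Equiv.ofInjective _ (algebraMap F L).injective)).symm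

variable [Fintype F] [FiniteDimensional F L] [IsGalois F L]

theorem card_fixed_one [DecidableEq F] (c : Fˣ) :
    Nat.card {x : {x : L // x ∉ Set.range (algebraMap F L)} // algebraMap F L c * x = x} =
      if c = 1 then Fintype.card F ^ Module.finrank F L - Fintype.card F else 0 := by
  split_ifs with h
  · subst h
    rw [← card_notMem_range_algebraMap]
    exact Nat.card_congr (Equiv.subtypeUnivEquiv fun x => by simp)
  · have : IsEmpty {x : {x : L // x ∉ Set.range (algebraMap F L)} //
        algebraMap F L c * x = x} := by
      constructor
      rintro ⟨x, hx⟩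
      have hx0 : (x : L) ≠ 0 := fun h0 => x.2 ⟨0, by rw [h0, map_zero]⟩
      have h1 : algebraMap F L c = 1 := mul_eq_right₀ hx0 |>.1 hx
      apply h
      ext
      exact (algebraMap F L).injective (by simpa using h1)
    simp

theorem card_fixed_generator (hr : (Module.finrank F L).Prime) {τ : L ≃ₐ[F] L}
    (hτ : ∀ ρ : L ≃ₐ[F] L, ρ ∈ Subgroup.zpowers τ) (c : Fˣ) :
    Nat.card {x : {x : L // x ∉ Set.range (algebraMap F L)} // algebraMap F L c * τ x = x} =
      if orderOf c = Module.finrank F L then Fintype.card F - 1 else 0 := by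
  classical
  split_ifs with h
  · obtain ⟨y, hy⟩ := exists_unit_mul_algEquiv_eq hτ (c := c)
      (by rw [h, orderOf_eq_finrank hτ])
    have hy0 := y.ne_zero
    have hc0 : algebraMap F L c ≠ 0 := by simp
    have hτ0 : τ y ≠ 0 := by simp
    rw [← Fintype.card_units, ← Nat.card_eq_fintype_card]
    symm
    refine Nat.card_congr (Equiv.ofBijective (fun f => ⟨⟨algebraMap F L f * y, ?_⟩, ?_⟩) ⟨?_, ?_⟩)
    · rintro ⟨z, hz⟩
      have hf0 : algebraMap F L f ≠ 0 := by simp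
      have h1 : τ (y : L) = y := by
        have h2 := congrArg τ hz
        rw [τ.commutes, map_mul, τ.commutes, hz] at h2
        exact (mul_left_cancel₀ hf0 h2).symm
      rw [h1] at hy
      have h3 : algebraMap F L c = 1 := mul_eq_right₀ hy0 |>.1 hy
      have h4 : c = 1 := by
        ext
        exact (algebraMap F L).injective (by simpa using h3)
      rw [h4, orderOf_one] at h
      exact hr.one_lt.ne h
    · simp only [map_mul, τ.commutes]
      linear_combination algebraMap F L f * hy
    · intro f g hfg
      have h1 : algebraMap F L f * y = algebraMap F L g * y :=
        congrArg (fun x => (x.1 : L)) hfg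
      ext
      exact (algebraMap F L).injective (mul_right_cancel₀ hy0 h1)
    · rintro ⟨⟨x, hx⟩, hxτ⟩
      have hx0 : x ≠ 0 := fun h0 => hx ⟨0, by rw [h0, map_zero]⟩
      simp only at hxτ
      obtain ⟨f, hf⟩ := mem_range_algebraMap_of_generator hτ (x := x / y) (by
        rw [map_div₀, div_eq_div_iff hτ0 hy0]
        apply mul_left_cancel₀ hc0
        linear_combination y * hxτ - x * hy)
      have hf0 : f ≠ 0 := by
        rintro rfl
        rw [map_zero] at hf
        exact div_ne_zero hx0 hy0 hf.symm
      refine ⟨Units.mk0 f hf0, Subtype.ext (Subtype.ext ?_)⟩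
      simp only [Units.val_mk0]
      rw [hf, div_mul_cancel₀ _ hy0]
  · have : IsEmpty {x : {x : L // x ∉ Set.range (algebraMap F L)} //
        algebraMap F L c * τ x = x} := by
      constructor
      rintro ⟨⟨x, hx⟩, hxτ⟩
      simp only at hxτ
      have hx0 : x ≠ 0 := fun h0 => hx ⟨0, by rw [h0, map_zero]⟩
      have := Fact.mk hr
      apply h
      apply orderOf_eq_prime
      · have h1 := congrArg (Algebra.norm F) hxτ
        rw [map_mul, Algebra.norm_algebraMap, ← Algebra.norm_eq_of_algEquiv τ x,
          Algebra.norm_eq_of_algEquiv τ] at h1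
        have h2 := mul_eq_right₀ (Algebra.norm_ne_zero_iff.2 hx0) |>.1 h1
        ext
        simpa using h2
      · rintro rfl
        exact hx (mem_range_algebraMap_of_generator hτ (by simpa using hxτ))
    simp

theorem card_orbits_mul (hr : (Module.finrank F L).Prime)
    {σ : L ≃ₐ[F] L} (hσ : ∀ τ : L ≃ₐ[F] L, τ ∈ Subgroup.zpowers σ) [DecidableEq F] :
    Nat.card (Quot (sandlerRel (F := F) (L := L) (Module.finrank F L) σ)) *
      ((Fintype.card F - 1) * Module.finrank F L) =
    Fintype.card F ^ Module.finrank F L - Fintype.card F +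
      (Finset.univ.filter fun c : Fˣ => orderOf c = Module.finrank F L).card *
        ((Module.finrank F L - 1) * (Fintype.card F - 1)) := by
  classical
  have : Finite L := Module.finite_of_finite F
  have := Fintype.ofFinite L
  have hfact : Fact (Module.finrank F L).Prime := ⟨hr⟩
  have hcard := IsGalois.card_aut_eq_finrank F L
  let X := {x : L // x ∉ Set.range (algebraMap F L)}
  let _ : MulAction (Fˣ × (L ≃ₐ[F] L)) X := unitsProdGalAction F L
  have hrel : sandlerRel (F := F) (L := L) (Module.finrank F L) σ =
      (MulAction.orbitRel (Fˣ × (L ≃ₐ[F] L)) X).r := by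
    ext a b
    rw [sandlerRel_iff hr hσ]
    constructor
    · rintro ⟨c, τ, h⟩
      refine ⟨(c, τ⁻¹), Subtype.ext ?_⟩
      change algebraMap F L c * τ⁻¹ b.1 = a.1
      apply τ.injective
      rw [map_mul, τ.commutes, h]
      congr 1
      exact τ.apply_symm_apply b.1
    · rintro ⟨⟨c, τ⟩, h⟩
      have h1 : algebraMap F L c * τ b.1 = a.1 := congrArg Subtype.val h
      refine ⟨c, τ⁻¹, ?_⟩
      rw [← h1, map_mul, AlgEquiv.commutes]
      congr 1
      exact τ.symm_apply_apply b.1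
  have hburn := MulAction.sum_card_fixedBy_eq_card_orbits_mul_card_group (Fˣ × (L ≃ₐ[F] L)) X
  have hfix : ∀ (c : Fˣ) (τ : L ≃ₐ[F] L),
      Fintype.card (MulAction.fixedBy X (c, τ)) = if τ = 1 then
        (if c = 1 then Fintype.card F ^ Module.finrank F L - Fintype.card F else 0)
      else (if orderOf c = Module.finrank F L then Fintype.card F - 1 else 0) := by
    intro c τ
    have h1 : Fintype.card (MulAction.fixedBy X (c, τ)) =
        Nat.card {x : X // algebraMap F L c * τ x = x} := by
      rw [← Nat.card_eq_fintype_card]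
      exact Nat.card_congr (Equiv.subtypeEquivRight fun x => Subtype.ext_iff)
    rw [h1]
    split_ifs with hτ
    · subst hτ
      exact (card_fixed_one c).trans (by simp [*])
    · subst hτ
      exact (card_fixed_one c).trans (by simp [*])
    · exact (card_fixed_generator hr
        (fun ρ => mem_zpowers_of_prime_card hcard hτ) c).trans (by simp [*])
    · exact (card_fixed_generator hr
        (fun ρ => mem_zpowers_of_prime_card hcard hτ) c).trans (by simp [*])
  have hinner : ∀ A B : ℕ, ∑ τ : L ≃ₐ[F] L, (if τ = 1 then A else B) =
      A + (Module.finrank F L - 1) * B := by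
    intro A B
    rw [← Finset.add_sum_erase _ _ (Finset.mem_univ 1), if_pos rfl,
      Finset.sum_congr rfl fun τ hτ => if_neg (Finset.ne_of_mem_erase hτ), Finset.sum_const,
      Finset.card_erase_of_mem (Finset.mem_univ _), Finset.card_univ, ← Nat.card_eq_fintype_card,
      hcard, smul_eq_mul]
  rw [Fintype.sum_prod_type] at hburn
  simp only [hfix, hinner] at hburn
  rw [Finset.sum_add_distrib, Finset.sum_ite_eq' Finset.univ (1 : Fˣ),
    if_pos (Finset.mem_univ _), ← Finset.mul_sum, ← Finset.sum_filter, Finset.sum_const,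
    smul_eq_mul, Fintype.card_prod, Fintype.card_units, ← Nat.card_eq_fintype_card (α := L ≃ₐ[F] L),
    hcard, ← Nat.card_eq_fintype_card (α := Quotient _)] at hburn
  rw [hrel]
  refine Eq.trans hburn.symm ?_
  ring

end Counting

theorem eq_add_div_of_mul_eq {K q r : ℕ} (hq : 1 < q) (hr : 0 < r)
    (h : K * ((q - 1) * r) = q ^ r - q + (r - 1) * ((r - 1) * (q - 1))) :
    K = r - 1 + (q ^ r - q - (q - 1) * (r - 1)) / (r * (q - 1)) := by
  obtain ⟨Q, rfl⟩ : ∃ Q, q = Q + 1 := ⟨q - 1, by omega⟩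
  obtain ⟨R, rfl⟩ : ∃ R, r = R + 1 := ⟨r - 1, by omega⟩
  simp only [Nat.add_sub_cancel] at h ⊢
  have hpos : 0 < (R + 1) * Q := by
    have : 0 < Q := by omega
    positivity
  have hbern : 1 + R * Q ≤ (1 + Q) ^ R := by
    simpa using one_add_mul_le_pow_of_sq_nonneg (a := Q) (Nat.zero_le _) (Nat.zero_le _)
      (Nat.zero_le _) R
  have hle : Q * R ≤ (Q + 1) ^ (R + 1) - (Q + 1) := by
    apply Nat.le_sub_of_add_le
    rw [pow_succ, add_comm Q 1]
    nlinarith [Nat.mul_le_mul_right (1 + Q) hbern, Nat.zero_le (R * Q * Q)]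
  obtain ⟨M, hM⟩ := Nat.exists_eq_add_of_le hle
  rw [hM] at h ⊢
  rw [Nat.add_sub_cancel_left]
  have hRK : R ≤ K := by
    by_contra! hlt
    nlinarith
  obtain ⟨D, rfl⟩ := Nat.exists_eq_add_of_le hRK
  congr 1
  symm
  apply Nat.div_eq_of_eq_mul_left hpos
  nlinarith

end CycAlg

/-- for `F = 𝔽_q` and `L/F` of prime degree `r`, the number of equivalence
classes of `a ∼ b ⟺ (L/F,σ,a) ≅ (L/F,σ,b)` on `L \ F` (equivalently, the number of
pairwise non-isomorphic Sandler semifields `(L/F, σ, a)`) is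
`r - 1 + (q^r - q - (q-1)(r-1))/(r(q-1))` if `r ∣ q - 1`, and `(q^r - q)/(r(q-1))`
otherwise. -/
theorem sandler_isomorphism_classes_count
    {F L : Type*} [Field F] [Fintype F] [Field L] [Algebra F L] [IsGalois F L]
    (q r : ℕ) (hq : Fintype.card F = q) (hr : r.Prime)
    (hrank : Module.finrank F L = r)
    (σ : L ≃ₐ[F] L) (hσ : ∀ τ : L ≃ₐ[F] L, τ ∈ Subgroup.zpowers σ) :
    (r ∣ q - 1 →
      Nat.card (Quot (sandlerRel (F := F) (L := L) r σ))
        = r - 1 + (q ^ r - q - (q - 1) * (r - 1)) / (r * (q - 1))) ∧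
    (¬ r ∣ q - 1 →
      Nat.card (Quot (sandlerRel (F := F) (L := L) r σ))
        = (q ^ r - q) / (r * (q - 1))) := by
  classical
  subst hrank
  have : FiniteDimensional F L := Module.finite_of_finrank_pos hr.pos
  have key := CycAlg.card_orbits_mul hr hσ
  have hq1 : 1 < q := hq ▸ Fintype.one_lt_card
  have hunits : Fintype.card Fˣ = q - 1 := by rw [Fintype.card_units, hq]
  rw [hq] at key
  constructor
  · intro hdvd
    rw [IsCyclic.card_orderOf_eq_totient (hunits ▸ hdvd), Nat.totient_prime hr] at key
    exact CycAlg.eq_add_div_of_mul_eq hq1 hr.pos key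
  · intro hdvd
    have hempty : (Finset.univ.filter fun c : Fˣ => orderOf c = Module.finrank F L) = ∅ := by
      refine Finset.filter_eq_empty_iff.2 fun c _ hc => hdvd ?_
      rw [← hunits, ← hc]
      exact orderOf_dvd_card
    rw [hempty, Finset.card_empty, zero_mul, add_zero] at key
    refine (Nat.div_eq_of_eq_mul_left (Nat.mul_pos hr.pos (by omega)) ?_).symm
    rw [← key, mul_comm (q - 1)]
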